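/- Let A, B, C be jointly distributed discrete random variables taking finitely many values in a commutative group. Then H(A + B + C) + H(A, B, C) ≤ H(A + B, C) + H(A, B + C). If A, B, C are independent, then H(A + B + C) + H(B) ≤ H(A + B) + H(B + C). If A, B, C are i.i.d., then H(A + B + C) + H(A) ≤ 2 H(A + B). -/

import Mathlib

/-- The probability of the event `E` under the probability mass function `p`
on a finite sample space. -/
noncomputable def prob {Ω : Type*} [Fintype Ω] (p : Ω → ℝ) (E : Set Ω) : ℝ :=
  ∑ ω, E.indicator p ω

/-- The Shannon entropy (base 2) of the discrete random variable `X` on the finite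
probability space given by the probability mass function `p`. -/
noncomputable def ent {Ω S : Type*} [Fintype Ω] (p : Ω → ℝ) (X : Ω → S) : ℝ :=
  letI := Classical.decEq S
  ∑ v ∈ Finset.univ.image X,
      -(prob p {ω | X ω = v} * Real.logb 2 (prob p {ω | X ω = v}))

open Classical in
/-- The probability that `X` takes the value it has at `ω`. -/
noncomputable def qq {Ω S : Type*} [Fintype Ω] (p : Ω → ℝ) (X : Ω → S) (ω : Ω) : ℝ :=
  ∑ a, if X a = X ω then p a else 0

lemma prob_eq_qq {Ω S : Type*} [Fintype Ω] (p : Ω → ℝ) (X : Ω → S) (ω : Ω) :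
    prob p {a | X a = X ω} = qq p X ω := by
  classical
  unfold prob qq
  refine Finset.sum_congr rfl fun a _ => ?_
  simp [Set.indicator_apply]

lemma ent_eq {Ω S : Type*} [Fintype Ω] (p : Ω → ℝ) (X : Ω → S) :
    ent p X = -∑ ω, p ω * Real.logb 2 (qq p X ω) := by
  classical
  unfold ent
  rw [← Finset.sum_neg_distrib]
  rw [← Finset.sum_fiberwise_of_maps_to (s := Finset.univ) (t := Finset.univ.image X) (g := X)
    (fun ω _ => Finset.mem_image_of_mem X (Finset.mem_univ ω))]
  have hd : (fun a b : S => Classical.propDecidable (a = b)) = Classical.decEq S :=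
    Subsingleton.elim _ _
  refine Finset.sum_congr (by congr) fun v _ => ?_
  rw [Finset.sum_congr rfl (g := fun ω => -(p ω * Real.logb 2 (prob p {ω | X ω = v})))]
  · rw [Finset.sum_neg_distrib, ← Finset.sum_mul, Finset.sum_filter]
    congr 2
  · intro ω hω
    have : X ω = v := by simpa using hω
    rw [← prob_eq_qq, this]

lemma qq_congr {Ω S T : Type*} [Fintype Ω] (p : Ω → ℝ) (X : Ω → S) (Y : Ω → T)
    (h : ∀ a b, X a = X b ↔ Y a = Y b) (ω : Ω) : qq p X ω = qq p Y ω := by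
  classical
  unfold qq
  refine Finset.sum_congr rfl fun a _ => ?_
  simp [h]

lemma ent_congr {Ω S T : Type*} [Fintype Ω] (p : Ω → ℝ) (X : Ω → S) (Y : Ω → T)
    (h : ∀ a b, X a = X b ↔ Y a = Y b) : ent p X = ent p Y := by
  simp only [ent_eq, qq_congr p X Y h]

lemma le_qq {Ω S : Type*} [Fintype Ω] (p : Ω → ℝ) (hp : ∀ ω, 0 ≤ p ω) (X : Ω → S) (ω : Ω) :
    p ω ≤ qq p X ω := by
  classical
  unfold qq
  have := Finset.single_le_sum (f := fun a => if X a = X ω then p a else 0) (s := Finset.univ)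
    (fun a _ => by split_ifs <;> simp [hp]) (Finset.mem_univ ω)
  simpa using this

lemma qq_nonneg {Ω S : Type*} [Fintype Ω] (p : Ω → ℝ) (hp : ∀ ω, 0 ≤ p ω) (X : Ω → S) (ω : Ω) :
    0 ≤ qq p X ω := (hp ω).trans (le_qq p hp X ω)

lemma key_sum {Ω S T R : Type*} [Fintype Ω] (p : Ω → ℝ)
    (hp : ∀ ω, 0 ≤ p ω) (hp1 : ∑ ω, p ω = 1) (U : Ω → S) (V : Ω → T) (Z : Ω → R)
    (hU : ∀ a b, U a = U b → Z a = Z b) (hV : ∀ a b, V a = V b → Z a = Z b) :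
    ∑ ω, p ω * (qq p U ω * qq p V ω / (qq p Z ω * qq p (fun ω => (U ω, V ω)) ω)) ≤ 1 := by
  classical
  set W := fun ω => (U ω, V ω) with hW
  have h1 : ∀ ω, p ω * (qq p U ω * qq p V ω / (qq p Z ω * qq p W ω)) =
      ∑ a, ∑ b, p a * p b / qq p Z a *
        (if U a = U ω ∧ V b = V ω then p ω / qq p W ω else 0) := by
    intro ω
    have : p ω * (qq p U ω * qq p V ω / (qq p Z ω * qq p W ω)) =
      qq p U ω * qq p V ω * (p ω / (qq p Z ω * qq p W ω)) := by ring
    rw [this]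
    conv_lhs => rw [qq, qq, Finset.sum_mul_sum, Finset.sum_mul]
    refine Finset.sum_congr rfl fun a _ => ?_
    rw [Finset.sum_mul]
    refine Finset.sum_congr rfl fun b _ => ?_
    by_cases ha : U a = U ω
    · by_cases hb : V b = V ω
      · have : qq p Z a = qq p Z ω := by unfold qq; rw [hU _ _ ha]
        simp only [ha, hb, this, if_true, and_self]
        rw [div_mul_div_comm, mul_div_assoc]
      · simp [hb]
    · simp [ha]
  have h2 : ∀ a b, ∑ ω, (if U a = U ω ∧ V b = V ω then p ω / qq p W ω else 0) ≤
      if Z b = Z a then 1 else 0 := by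
    intro a b
    by_cases hex : ∃ c, U a = U c ∧ V b = V c
    · obtain ⟨c, hca, hcb⟩ := hex
      rw [if_pos ((hV _ _ hcb).trans (hU _ _ hca).symm)]
      have : ∀ ω, (if U a = U ω ∧ V b = V ω then p ω / qq p W ω else 0) =
          (if W ω = W c then p ω else 0) / qq p W c := by
        intro ω
        have e : (U a = U ω ∧ V b = V ω) ↔ W ω = W c := by
          rw [hca, hcb, hW]; simp only [Prod.mk.injEq]
          exact and_congr eq_comm eq_comm
        by_cases h : W ω = W c
        · rw [if_pos (e.2 h), if_pos h]; unfold qq; rw [h]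
        · rw [if_neg (fun h' => h (e.1 h')), if_neg h, zero_div]
      rw [Finset.sum_congr rfl fun ω _ => this ω, ← Finset.sum_div]
      have hq : (∑ i, if W i = W c then p i else 0) = qq p W c := by
        unfold qq
        refine Finset.sum_congr rfl fun i _ => ?_
        congr
      rw [hq]
      exact div_self_le_one (qq p W c)
    · push Not at hex
      rw [Finset.sum_eq_zero]
      · split_ifs <;> simp
      · intro ω _
        rw [if_neg]
        rintro ⟨h, h'⟩
        exact hex ω h h'
  calc _ = ∑ a, ∑ b, p a * p b / qq p Z a *
        ∑ ω, (if U a = U ω ∧ V b = V ω then p ω / qq p W ω else 0) := by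
        rw [Finset.sum_congr rfl fun ω _ => h1 ω, Finset.sum_comm]
        refine Finset.sum_congr rfl fun a _ => ?_
        rw [Finset.sum_comm]
        refine Finset.sum_congr rfl fun b _ => ?_
        rw [Finset.mul_sum]
    _ ≤ ∑ a, ∑ b, p a * p b / qq p Z a * (if Z b = Z a then 1 else 0) := by
        refine Finset.sum_le_sum fun a _ => Finset.sum_le_sum fun b _ => ?_
        exact mul_le_mul_of_nonneg_left (h2 a b)
          (div_nonneg (mul_nonneg (hp a) (hp b)) (qq_nonneg p hp Z a))
    _ = ∑ a, p a * (qq p Z a / qq p Z a) := by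
        refine Finset.sum_congr rfl fun a _ => ?_
        rw [show p a * (qq p Z a / qq p Z a) = (p a / qq p Z a) * qq p Z a by ring]
        have : ∀ x : ℝ, x * qq p Z a = ∑ b, x * (if Z b = Z a then p b else 0) := by
          intro x; rw [← Finset.mul_sum]; rfl
        rw [this]
        refine Finset.sum_congr rfl fun b _ => ?_
        split_ifs <;> ring
    _ ≤ ∑ a, p a := Finset.sum_le_sum fun a _ =>
        mul_le_of_le_one_right (hp a) (div_self_le_one _)
    _ = 1 := hp1

lemma ent_submod {Ω S T R : Type*} [Fintype Ω] (p : Ω → ℝ)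
    (hp : ∀ ω, 0 ≤ p ω) (hp1 : ∑ ω, p ω = 1) (U : Ω → S) (V : Ω → T) (Z : Ω → R)
    (hU : ∀ a b, U a = U b → Z a = Z b) (hV : ∀ a b, V a = V b → Z a = Z b) :
    ent p Z + ent p (fun ω => (U ω, V ω)) ≤ ent p U + ent p V := by
  have key := key_sum p hp hp1 U V Z hU hV
  simp only [ent_eq]
  set W := fun ω => (U ω, V ω) with hW
  have hl : 0 < Real.log 2 := Real.log_pos (by norm_num)
  have h : ∀ ω, p ω * Real.logb 2 (qq p U ω) + p ω * Real.logb 2 (qq p V ω)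
      - p ω * Real.logb 2 (qq p Z ω) - p ω * Real.logb 2 (qq p W ω) ≤
      (p ω * (qq p U ω * qq p V ω / (qq p Z ω * qq p W ω)) - p ω) / Real.log 2 := by
    intro ω
    rcases (hp ω).eq_or_lt with h0 | h0
    · simp [← h0]
    have u := h0.trans_le (le_qq p hp U ω)
    have v := h0.trans_le (le_qq p hp V ω)
    have z := h0.trans_le (le_qq p hp Z ω)
    have w := h0.trans_le (le_qq p hp W ω)
    have hlog := Real.log_le_sub_one_of_pos (div_pos (mul_pos u v) (mul_pos z w))
    rw [Real.log_div (by positivity) (by positivity), Real.log_mul u.ne' v.ne',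
      Real.log_mul z.ne' w.ne'] at hlog
    rw [le_div_iff₀ hl]
    simp only [Real.logb]
    have := mul_le_mul_of_nonneg_left hlog h0.le
    field_simp at this ⊢
    linarith
  have hs := Finset.sum_le_sum fun ω (_ : ω ∈ Finset.univ) => h ω
  rw [← Finset.sum_div, Finset.sum_sub_distrib, Finset.sum_sub_distrib, Finset.sum_sub_distrib,
    Finset.sum_add_distrib, hp1] at hs
  have : (∑ ω, p ω * (qq p U ω * qq p V ω / (qq p Z ω * qq p W ω)) - 1) / Real.log 2 ≤ 0 :=
    div_nonpos_of_nonpos_of_nonneg (by linarith) hl.le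
  linarith

lemma qq_const {Ω : Type*} [Fintype Ω] (p : Ω → ℝ) (hp1 : ∑ ω, p ω = 1) :
    ent p (fun _ : Ω => ()) = 0 := by
  simp [ent_eq, qq, hp1]

lemma ent_subadd {Ω S T : Type*} [Fintype Ω] (p : Ω → ℝ)
    (hp : ∀ ω, 0 ≤ p ω) (hp1 : ∑ ω, p ω = 1) (U : Ω → S) (V : Ω → T) :
    ent p (fun ω => (U ω, V ω)) ≤ ent p U + ent p V := by
  have := ent_submod p hp hp1 U V (fun _ => ()) (fun _ _ _ => rfl) (fun _ _ _ => rfl)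
  rwa [qq_const p hp1, zero_add] at this

lemma ent_indep {Ω G : Type*} [Fintype Ω] (p : Ω → ℝ)
    (hp : ∀ ω, 0 ≤ p ω) (A B C : Ω → G)
    (h : ∀ a b c : G, prob p {ω | A ω = a ∧ B ω = b ∧ C ω = c} =
        prob p {ω | A ω = a} * prob p {ω | B ω = b} * prob p {ω | C ω = c}) :
    ent p (fun ω => (A ω, B ω, C ω)) = ent p A + ent p B + ent p C := by
  have hq : ∀ ω, qq p (fun ω => (A ω, B ω, C ω)) ω = qq p A ω * qq p B ω * qq p C ω := by
    intro ω
    have := h (A ω) (B ω) (C ω)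
    rw [prob_eq_qq, prob_eq_qq, prob_eq_qq] at this
    rw [← this, ← prob_eq_qq]
    simp only [Prod.mk.injEq]
  simp only [ent_eq]
  rw [← neg_add, ← neg_add, ← Finset.sum_add_distrib, ← Finset.sum_add_distrib]
  congr 1
  refine Finset.sum_congr rfl fun ω _ => ?_
  rcases (hp ω).eq_or_lt with h0 | h0
  · simp [← h0]
  have u := h0.trans_le (le_qq p hp A ω)
  have v := h0.trans_le (le_qq p hp B ω)
  have w := h0.trans_le (le_qq p hp C ω)
  rw [hq, Real.logb_mul (by positivity) w.ne', Real.logb_mul u.ne' v.ne']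
  ring

lemma prob_empty_of {Ω : Type*} [Fintype Ω] (p : Ω → ℝ) (E : Set Ω) (h : ∀ ω, ω ∉ E) :
    prob p E = 0 := by
  unfold prob
  exact Finset.sum_eq_zero fun ω _ => Set.indicator_of_notMem (h ω) _

lemma ent_eq_of_dist {Ω S : Type*} [Fintype Ω] (p : Ω → ℝ) (X Y : Ω → S)
    (h : ∀ v, prob p {ω | X ω = v} = prob p {ω | Y ω = v}) : ent p X = ent p Y := by
  letI := Classical.decEq S
  have aux : ∀ (X : Ω → S) (s : Finset S), Finset.univ.image X ⊆ s → ent p X =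
      ∑ v ∈ s, -(prob p {ω | X ω = v} * Real.logb 2 (prob p {ω | X ω = v})) := by
    intro X s hs
    refine Finset.sum_subset hs fun v _ hv => ?_
    rw [prob_empty_of]
    · simp
    · intro ω hω
      exact hv (Finset.mem_image.2 ⟨ω, Finset.mem_univ _, hω⟩)
  rw [aux X _ (Finset.subset_union_left (s₂ := Finset.univ.image Y)),
    aux Y _ (Finset.subset_union_right (s₁ := Finset.univ.image X))]
  simp only [h]

lemma prob_fiber {Ω S : Type*} [Fintype Ω] (p : Ω → ℝ) (X : Ω → S) (s : Finset S)
    (hs : ∀ ω, X ω ∈ s) (E : Set Ω) :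
    prob p E = ∑ v ∈ s, prob p {ω | X ω = v ∧ ω ∈ E} := by
  classical
  unfold prob
  rw [Finset.sum_comm]
  refine Finset.sum_congr rfl fun ω _ => ?_
  rw [Finset.sum_eq_single (X ω)]
  · simp [Set.indicator_apply]
  · intro v _ hv
    simp [Set.indicator_apply, hv.symm]
  · intro h; exact absurd (hs ω) h

lemma prob_univ_fiber {Ω S : Type*} [Fintype Ω] (p : Ω → ℝ) (hp1 : ∑ ω, p ω = 1)
    (X : Ω → S) (s : Finset S) (hs : ∀ ω, X ω ∈ s) :
    ∑ v ∈ s, prob p {ω | X ω = v} = 1 := by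
  have := prob_fiber p X s hs Set.univ
  simp only [Set.mem_univ, and_true] at this
  rw [← this]
  simp [prob, hp1]

lemma prob_sum_conv {Ω G : Type*} [Fintype Ω] [AddCommGroup G] (p : Ω → ℝ)
    (X Y : Ω → G) (s : Finset G) (hs : ∀ ω, X ω ∈ s)
    (h : ∀ a b, prob p {ω | X ω = a ∧ Y ω = b} = prob p {ω | X ω = a} * prob p {ω | Y ω = b})
    (g : G) : prob p {ω | X ω + Y ω = g} =
      ∑ a ∈ s, prob p {ω | X ω = a} * prob p {ω | Y ω = g - a} := by
  rw [prob_fiber p X s hs]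
  refine Finset.sum_congr rfl fun a _ => ?_
  rw [← h]
  congr 1
  ext ω
  simp only [Set.mem_ofPred_eq]
  refine and_congr_right fun ha => ?_
  rw [ha, eq_sub_iff_add_eq, add_comm]

theorem entropy_plunnecke_ruzsa {Ω G : Type*} [Fintype Ω] [AddCommGroup G] (p : Ω → ℝ)
    (hp : ∀ ω, 0 ≤ p ω) (hp1 : ∑ ω, p ω = 1) (A B C : Ω → G) :
    (ent p (fun ω => A ω + B ω + C ω) + ent p (fun ω => (A ω, B ω, C ω)) ≤
      ent p (fun ω => (A ω + B ω, C ω)) + ent p (fun ω => (A ω, B ω + C ω))) ∧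
    ((∀ a b c : G, prob p {ω | A ω = a ∧ B ω = b ∧ C ω = c} =
        prob p {ω | A ω = a} * prob p {ω | B ω = b} * prob p {ω | C ω = c}) →
      ent p (fun ω => A ω + B ω + C ω) + ent p B ≤
        ent p (fun ω => A ω + B ω) + ent p (fun ω => B ω + C ω)) ∧
    ((∀ a b c : G, prob p {ω | A ω = a ∧ B ω = b ∧ C ω = c} =
        prob p {ω | A ω = a} * prob p {ω | B ω = b} * prob p {ω | C ω = c}) →
      (∀ g : G, prob p {ω | B ω = g} = prob p {ω | A ω = g}) →
      (∀ g : G, prob p {ω | C ω = g} = prob p {ω | A ω = g}) →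
      ent p (fun ω => A ω + B ω + C ω) + ent p A ≤ 2 * ent p (fun ω => A ω + B ω)) := by
  classical
  have h1 : ent p (fun ω => A ω + B ω + C ω) + ent p (fun ω => (A ω, B ω, C ω)) ≤
      ent p (fun ω => (A ω + B ω, C ω)) + ent p (fun ω => (A ω, B ω + C ω)) := by
    have := ent_submod p hp hp1 (fun ω => (A ω + B ω, C ω)) (fun ω => (A ω, B ω + C ω))
      (fun ω => A ω + B ω + C ω)
      (fun a b h => by
        simp only [Prod.mk.injEq] at h
        rw [h.1, h.2])
      (fun a b h => by
        simp only [Prod.mk.injEq] at h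
        rw [add_assoc, add_assoc, h.1, h.2])
    rwa [ent_congr p (fun ω => ((A ω + B ω, C ω), (A ω, B ω + C ω)))
      (fun ω => (A ω, B ω, C ω))] at this
    intro a b
    simp only [Prod.mk.injEq]
    constructor
    · rintro ⟨⟨h1, h2⟩, h3, h4⟩
      rw [h3] at h1
      exact ⟨h3, add_left_cancel h1, h2⟩
    · rintro ⟨h1, h2, h3⟩
      simp [h1, h2, h3]
  have h2 : (∀ a b c : G, prob p {ω | A ω = a ∧ B ω = b ∧ C ω = c} =
        prob p {ω | A ω = a} * prob p {ω | B ω = b} * prob p {ω | C ω = c}) →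
      ent p (fun ω => A ω + B ω + C ω) + ent p B ≤
        ent p (fun ω => A ω + B ω) + ent p (fun ω => B ω + C ω) := by
    intro h
    have e := ent_indep p hp A B C h
    have s1 := ent_subadd p hp hp1 (fun ω => A ω + B ω) C
    have s2 := ent_subadd p hp hp1 A (fun ω => B ω + C ω)
    linarith
  refine ⟨h1, h2, fun h hB hC => ?_⟩
  have h3 := h2 h
  have eB : ent p B = ent p A := ent_eq_of_dist p B A hB
  have hAB : ∀ a b, prob p {ω | A ω = a ∧ B ω = b} =
      prob p {ω | A ω = a} * prob p {ω | B ω = b} := by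
    intro a b
    have hs : ∀ ω, C ω ∈ Finset.univ.image C := fun ω =>
      Finset.mem_image_of_mem C (Finset.mem_univ ω)
    rw [prob_fiber p C _ hs {ω | A ω = a ∧ B ω = b}]
    rw [← mul_one (prob p {ω | A ω = a} * prob p {ω | B ω = b}),
      ← prob_univ_fiber p hp1 C _ hs, Finset.mul_sum]
    refine Finset.sum_congr rfl fun c _ => ?_
    rw [← h]
    congr 1
    ext ω
    simp only [Set.mem_ofPred_eq]
    tauto
  have hBC : ∀ b c, prob p {ω | B ω = b ∧ C ω = c} =
      prob p {ω | B ω = b} * prob p {ω | C ω = c} := by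
    intro b c
    have hs : ∀ ω, A ω ∈ Finset.univ.image A := fun ω =>
      Finset.mem_image_of_mem A (Finset.mem_univ ω)
    rw [prob_fiber p A _ hs {ω | B ω = b ∧ C ω = c}]
    rw [← one_mul (prob p {ω | B ω = b} * prob p {ω | C ω = c}),
      ← prob_univ_fiber p hp1 A _ hs, Finset.sum_mul]
    refine Finset.sum_congr rfl fun a _ => ?_
    rw [← mul_assoc, ← h]
    rfl
  have eBC : ent p (fun ω => B ω + C ω) = ent p (fun ω => A ω + B ω) := by
    refine ent_eq_of_dist p _ _ fun g => ?_
    rw [prob_sum_conv p B C (Finset.univ.image A ∪ Finset.univ.image B) (by simp) hBC,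
      prob_sum_conv p A B (Finset.univ.image A ∪ Finset.univ.image B) (by simp) hAB]
    refine Finset.sum_congr rfl fun a _ => ?_
    rw [hB, hC, hB]
  linarith
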